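/- For every real N > 0 and every real c > 0, the shifted distributions converge to q(N,c) in ℓ¹: lim_{n→∞} Σ_{k∈ℤ} | P̃_{n+k}(N,n,c/n) − q_k(N,c) | = 0, where P̃_j(N,n,c/n) := P_j(N,n,c/n) for j ≥ 0 and P̃_j(N,n,c/n) := 0 for j < 0, and the limit is over integers n > c. (This is the trace-norm convergence of the unitarily shifted states T_{−n} Φ_{c/n,|n⟩⟨n|}(τ_N) T_{−n}† to the diagonal state with eigenvalues q_k(N,c).) -/

import Mathlib

/-- The eigenvalues `P_l(N,n,λ)` of the Fock-diagonal state `Φ_{λ,|n⟩⟨n|}(τ_N)`. -/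
noncomputable def Pl (N : ℝ) (n l : ℕ) (lam : ℝ) : ℝ :=
  ((1 + N * lam) ^ (l + n + 1))⁻¹ *
    ∑ m ∈ Finset.Icc (n - l) n,
      lam ^ (2 * m + l - n) * (1 - lam) ^ (n - m) * N ^ (l + m - n) * (N + 1) ^ m *
        (n.choose m : ℝ) * (l.choose (n - m) : ℝ)

/-- The limiting distribution `q_k(N,c)` on `ℤ`. -/
noncomputable def qdist (N c : ℝ) (k : ℤ) : ℝ :=
  Real.exp (-c * (2 * N + 1)) *
    (if 0 ≤ k then (c * N) ^ k.natAbs else (c * (N + 1)) ^ k.natAbs) *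
    ∑' m : ℕ, (c ^ 2 * N * (N + 1)) ^ m / ((m.factorial : ℝ) * ((m + k.natAbs).factorial : ℝ))

open Filter Topology

/-- Term of the double sum. -/
noncomputable def Fterm (N lam : ℝ) (n : ℕ) (p : ℕ × ℕ) : ℝ :=
  if p.1 ≤ n then
    ((1 + N * lam) ^ ((n - p.1 + p.2) + n + 1))⁻¹ *
      (((n.choose p.1 : ℝ) * lam ^ p.1 * (1 - lam) ^ (n - p.1)) * (N + 1) ^ p.1 *
        (((n - p.1 + p.2).choose p.2 : ℝ) * lam ^ p.2) * N ^ p.2)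
  else 0

/-- Limit term. -/
noncomputable def Gterm (N c : ℝ) (p : ℕ × ℕ) : ℝ :=
  Real.exp (-c * (2 * N + 1)) * (((c * (N + 1)) ^ p.1 / (p.1.factorial : ℝ)) *
    ((c * N) ^ p.2 / (p.2.factorial : ℝ)))

/-- Reparametrisation. -/
def eqv : ℤ × ℕ ≃ ℕ × ℕ where
  toFun x := (x.2 + (-x.1).toNat, x.2 + x.1.toNat)
  invFun p := ((p.2 : ℤ) - p.1, min p.1 p.2)
  left_inv := by
    rintro ⟨k, m⟩
    ext <;> simp <;> omega
  right_inv := by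
    rintro ⟨a, b⟩
    ext <;> simp <;> omega

lemma eqv_apply (k : ℤ) (m : ℕ) : eqv (k, m) = (m + (-k).toNat, m + k.toNat) := rfl

lemma lam_tendsto (c : ℝ) : Tendsto (fun n : ℕ => (n : ℝ) * (c / n)) atTop (𝓝 c) := by
  refine tendsto_const_nhds.congr' ?_
  filter_upwards [eventually_ge_atTop 1] with n hn
  have : (n : ℝ) ≠ 0 := by positivity
  field_simp

lemma choose_tendsto (c : ℝ) (a b : ℕ) :
    Tendsto (fun n : ℕ => ((n - a + b).choose b : ℝ) * (c / n) ^ b) atTop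
      (𝓝 (c ^ b / b.factorial)) := by
  have h1 : Tendsto (fun M : ℕ => (M : ℝ) * (c / ((M + a - b : ℕ) : ℝ))) atTop (𝓝 c) := by
    have h2 : Tendsto (fun M : ℕ => c / ((M + a - b : ℕ) : ℝ)) atTop (𝓝 0) := by
      refine tendsto_const_nhds.div_atTop (tendsto_natCast_atTop_atTop.comp ?_)
      exact tendsto_atTop_mono (fun M => (by omega : M - b ≤ M + a - b)) (tendsto_sub_atTop_nat b)
    have h3 : Tendsto (fun M : ℕ => c + ((b : ℝ) - a) * (c / ((M + a - b : ℕ) : ℝ)))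
        atTop (𝓝 c) := by
      simpa using (h2.const_mul ((b : ℝ) - a)).const_add c
    refine h3.congr' ?_
    filter_upwards [eventually_ge_atTop (b + 1)] with M hM
    have h4 : ((M + a - b : ℕ) : ℝ) = M + a - b := by
      rw [Nat.cast_sub (by omega)]; push_cast; ring
    have h5 : ((M + a - b : ℕ) : ℝ) ≠ 0 := by
      have : M + a - b ≠ 0 := by omega
      exact_mod_cast this
    rw [h4] at h5 ⊢
    field_simp
    ring
  have h6 := ProbabilityTheory.tendsto_choose_mul_pow_atTop b h1
  have h7 : Tendsto (fun n : ℕ => n - a + b) atTop atTop :=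
    tendsto_atTop_mono (fun n => Nat.le_add_right _ _) (tendsto_sub_atTop_nat a)
  refine (h6.comp h7).congr' ?_
  filter_upwards [eventually_ge_atTop a] with n hn
  simp only [Function.comp]
  congr 4
  omega

lemma pref_tendsto (t : ℝ) (a b : ℕ) :
    Tendsto (fun n : ℕ => (1 + t / n) ^ ((n - a + b) + n + 1)) atTop
      (𝓝 (Real.exp (2 * t))) := by
  have h0 : Tendsto (fun n : ℕ => 1 + t / (n : ℝ)) atTop (𝓝 1) := by
    simpa using (tendsto_const_div_atTop_nhds_zero_nat t).const_add 1
  have h1 := Real.tendsto_one_add_div_pow_exp t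
  have h2 := ((h1.mul h1).mul (h0.pow (b + 1))).mul ((h0.pow a).inv₀ (by simp))
  have h3 : Real.exp t * Real.exp t * 1 ^ (b + 1) * (1 ^ a)⁻¹ = Real.exp (2 * t) := by
    rw [two_mul, Real.exp_add]; simp
  rw [h3] at h2
  refine h2.congr' ?_
  filter_upwards [eventually_ge_atTop a, h0.eventually_ne one_ne_zero] with n hn hne
  have : n = (n - a) + a := by omega
  have h4 : (1 + t / (n : ℝ)) ^ n = (1 + t / (n : ℝ)) ^ (n - a) * (1 + t / (n : ℝ)) ^ a := by
    rw [← pow_add, ← this]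
  rw [pow_add, pow_add, pow_add, pow_add]
  nth_rewrite 1 [h4]
  field_simp

lemma Fterm_tendsto (N c : ℝ) (p : ℕ × ℕ) :
    Tendsto (fun n : ℕ => Fterm N (c / n) n p) atTop (𝓝 (Gterm N c p)) := by
  have h1 := (pref_tendsto (N * c) p.1 p.2).inv₀ (Real.exp_ne_zero _)
  have h2 := ProbabilityTheory.tendsto_choose_mul_pow_of_tendsto_mul_atTop p.1 (lam_tendsto c)
  have h3 := choose_tendsto c p.1 p.2
  have h4 := h1.mul (((h2.mul_const ((N + 1) ^ p.1)).mul h3).mul_const (N ^ p.2))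
  have h5 : (Real.exp (2 * (N * c)))⁻¹ * (Real.exp (-c) * c ^ p.1 / p.1.factorial * (N + 1) ^ p.1 *
      (c ^ p.2 / p.2.factorial) * N ^ p.2) = Gterm N c p := by
    unfold Gterm
    rw [show -c * (2 * N + 1) = -(2 * (N * c)) + -c by ring, Real.exp_add, Real.exp_neg (2 * _),
      mul_pow, mul_pow]
    ring
  rw [h5] at h4
  refine h4.congr' ?_
  filter_upwards [eventually_ge_atTop p.1] with n hn
  simp only [Fterm, if_pos hn, mul_div_assoc]

lemma choose_dom (n0 n b : ℕ) (h0 : 0 < n0) (h : n0 ≤ n) :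
    ((n + b).choose b : ℝ) * (1 / n) ^ b ≤ ((n0 + b).choose b : ℝ) * (1 / n0) ^ b := by
  induction b with
  | zero => simp
  | succ b ih =>
    have key : ∀ m : ℕ, 0 < m → ((m + (b + 1)).choose (b + 1) : ℝ) * (1 / m) ^ (b + 1) =
        (((m + b).choose b : ℝ) * (1 / m) ^ b) * ((1 + (b + 1) * (1 / (m : ℝ))) / (b + 1)) := by
      intro m hm
      have h1 := Nat.add_one_mul_choose_eq (m + b) b
      have h2 : ((m : ℝ) + b + 1) * ((m + b).choose b : ℝ) =
        ((m + (b + 1)).choose (b + 1) : ℝ) * (b + 1) := by exact_mod_cast h1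
      have h3 : ((m + (b + 1)).choose (b + 1) : ℝ) =
          ((m : ℝ) + b + 1) * ((m + b).choose b : ℝ) / (b + 1) := by
        rw [h2]; field_simp
      rw [h3]
      have : (m : ℝ) ≠ 0 := by positivity
      rw [pow_succ]
      field_simp
      ring
    rw [key n (by omega), key n0 h0]
    have : (1 : ℝ) / n ≤ 1 / n0 := by
      apply one_div_le_one_div_of_le <;> [exact_mod_cast h0; exact_mod_cast h]
    gcongr

/-- dominating function -/
noncomputable def bnd (N c : ℝ) (n0 : ℕ) (p : ℕ × ℕ) : ℝ :=
  ((c * (N + 1)) ^ p.1 / (p.1.factorial : ℝ)) *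
    (((p.2 + n0).choose n0 : ℝ) * (c * N / n0) ^ p.2)

lemma Fterm_nonneg (N c : ℝ) (hN : 0 < N) (hc : 0 < c) (n : ℕ) (hn : c ≤ n) (p : ℕ × ℕ) :
    0 ≤ Fterm N (c / n) n p := by
  have hn' : (0 : ℝ) < n := hc.trans_le hn
  have : 0 ≤ 1 - c / n := by rw [sub_nonneg, div_le_one hn']; exact hn
  unfold Fterm
  split_ifs <;> positivity

lemma Fterm_le (N c : ℝ) (hN : 0 < N) (hc : 0 < c) (n0 n : ℕ) (h0 : 0 < n0) (h : n0 ≤ n)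
    (hn : c ≤ n) (p : ℕ × ℕ) : Fterm N (c / n) n p ≤ bnd N c n0 p := by
  have hn' : (0 : ℝ) < n := hc.trans_le hn
  have h1 : 0 ≤ 1 - c / n := by rw [sub_nonneg, div_le_one hn']; exact hn
  have h1' : 1 - c / n ≤ 1 := by
    have : 0 ≤ c / n := by positivity
    linarith
  obtain ⟨a, b⟩ := p
  unfold Fterm bnd
  dsimp only
  split_ifs with hab
  · have e1 : ((1 + N * (c / n)) ^ ((n - a + b) + n + 1))⁻¹ ≤ 1 := by
      apply inv_le_one_of_one_le₀
      apply one_le_pow₀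
      have : 0 ≤ N * (c / n) := by positivity
      linarith
    have e2 : (n.choose a : ℝ) * (c / n) ^ a * (1 - c / n) ^ (n - a) ≤ c ^ a / a.factorial := by
      have := Nat.choose_le_pow_div (α := ℝ) a n
      calc _ ≤ ((n : ℝ) ^ a / a.factorial) * (c / n) ^ a * 1 := by
            gcongr
            exact pow_le_one₀ h1 h1'
        _ = _ := by rw [div_pow]; field_simp
    have e3 : ((n - a + b).choose b : ℝ) * (c / n) ^ b ≤
        ((b + n0).choose n0 : ℝ) * (c / n0) ^ b := by
      have := choose_dom n0 n b h0 h
      calc _ ≤ ((n + b).choose b : ℝ) * (c / n) ^ b := by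
            gcongr
            omega
        _ = c ^ b * (((n + b).choose b : ℝ) * (1 / n) ^ b) := by
            rw [div_pow, div_pow, one_pow]; ring
        _ ≤ c ^ b * (((n0 + b).choose b : ℝ) * (1 / n0) ^ b) := by gcongr
        _ = _ := by
            rw [add_comm n0 b, Nat.choose_symm_add, div_pow, div_pow, one_pow]; ring
    calc _ ≤ 1 * (c ^ a / a.factorial * (N + 1) ^ a *
          (((b + n0).choose n0 : ℝ) * (c / n0) ^ b) * N ^ b) := by gcongr
      _ = _ := by rw [mul_pow, div_pow, div_pow, mul_pow]; ring
  · positivity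

lemma bnd_nonneg (N c : ℝ) (hN : 0 < N) (hc : 0 < c) (n0 : ℕ) (p : ℕ × ℕ) :
    0 ≤ bnd N c n0 p := by
  unfold bnd; positivity

lemma Gterm_nonneg (N c : ℝ) (hN : 0 < N) (hc : 0 < c) (p : ℕ × ℕ) :
    0 ≤ Gterm N c p := by
  unfold Gterm; positivity

lemma bnd_summable (N c : ℝ) (hN : 0 < N) (hc : 0 < c) (n0 : ℕ) (h : c * N < n0) :
    Summable (bnd N c n0) := by
  have h0 : (0 : ℝ) < n0 := lt_trans (by positivity) h
  have hr : ‖c * N / n0‖ < 1 := by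
    rw [Real.norm_of_nonneg (by positivity), div_lt_one h0]; exact h
  have hs := summable_choose_mul_geometric_of_norm_lt_one n0 hr
  have hs2 := Real.summable_pow_div_factorial (c * (N + 1))
  unfold bnd
  refine Summable.mul_of_nonneg hs2 hs ?_ ?_
  · intro i; simp only [Pi.zero_apply]; positivity
  · intro i; simp only [Pi.zero_apply]; positivity

lemma Gterm_summable (N c : ℝ) (hN : 0 < N) (hc : 0 < c) :
    Summable (Gterm N c) := by
  have hs1 := Real.summable_pow_div_factorial (c * (N + 1))
  have hs2 := Real.summable_pow_div_factorial (c * N)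
  unfold Gterm
  refine Summable.mul_left _ (Summable.mul_of_nonneg hs1 hs2 ?_ ?_)
  · intro i; simp only [Pi.zero_apply]; positivity
  · intro i; simp only [Pi.zero_apply]; positivity

lemma qdist_eq (N c : ℝ) (k : ℤ) : qdist N c k = ∑' m : ℕ, Gterm N c (eqv (k, m)) := by
  unfold qdist
  rw [← tsum_mul_left]
  congr 1
  ext m
  rw [eqv_apply]
  simp only [Gterm]
  split_ifs with hk
  · obtain ⟨j, rfl⟩ := Int.eq_ofNat_of_zero_le hk
    simp only [Int.natAbs_natCast, Int.toNat_neg_natCast, Int.toNat_natCast, add_zero]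
    rw [pow_add, mul_pow, mul_pow, mul_pow, mul_pow]
    field_simp
    rw [mul_pow c N m]
    ring
  · obtain ⟨j, rfl⟩ : ∃ j : ℕ, k = -(j : ℤ) := ⟨k.natAbs, by omega⟩
    simp only [Int.natAbs_neg, Int.natAbs_natCast, Int.toNat_neg_natCast, neg_neg,
      Int.toNat_natCast, add_zero]
    rw [pow_add, mul_pow, mul_pow, mul_pow, mul_pow]
    field_simp
    rw [mul_pow c N m]
    ring

lemma Pl_eq (N lam : ℝ) (n : ℕ) (k : ℤ) :
    (if 0 ≤ (n : ℤ) + k then Pl N n ((n : ℤ) + k).toNat lam else 0) =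
      ∑' m : ℕ, Fterm N lam n (eqv (k, m)) := by
  split_ifs with h
  · generalize hl : ((n : ℤ) + k).toNat = l
    have ha : (-k).toNat = n - l := by omega
    rw [tsum_eq_sum (s := Finset.range (n + 1 - (n - l)))]
    · unfold Pl
      rw [← Finset.Ico_add_one_right_eq_Icc, Finset.sum_Ico_eq_sum_range, Finset.mul_sum]
      refine Finset.sum_congr rfl fun m hm => ?_
      rw [Finset.mem_range] at hm
      rw [eqv_apply]
      simp only [Fterm]
      rw [if_pos (by omega)]
      generalize hA : m + (-k).toNat = a
      generalize hB : m + k.toNat = b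
      have e1 : n - l + m = a := by omega
      rw [e1]
      have e2 : n - a + b = l := by omega
      have e3 : 2 * a + l - n = a + b := by omega
      have e4 : l + a - n = b := by omega
      have e5 : l.choose (n - a) = l.choose b := by
        rw [← e2, Nat.choose_symm_add]
      rw [e2, e3, e4, e5, pow_add lam]
      ring
    · intro m hm
      rw [Finset.mem_range] at hm
      rw [eqv_apply]
      simp only [Fterm]
      rw [if_neg (by omega)]
  · symm
    convert tsum_zero with m
    rw [eqv_apply]
    simp only [Fterm]
    rw [if_neg (by omega)]

lemma abstract_le (e : ℤ × ℕ ≃ ℕ × ℕ) (F G : ℕ × ℕ → ℝ) (f g : ℤ → ℝ)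
    (hF : Summable F) (hG : Summable G)
    (hf : ∀ k, f k = ∑' m : ℕ, F (e (k, m))) (hg : ∀ k, g k = ∑' m : ℕ, G (e (k, m))) :
    ∑' k : ℤ, |f k - g k| ≤ ∑' p, |F p - G p| := by
  have hF' : Summable fun x => F (e x) := e.summable_iff.mpr hF
  have hG' : Summable fun x => G (e x) := e.summable_iff.mpr hG
  have hA : Summable fun x => |F (e x) - G (e x)| := (hF'.sub hG').abs
  rw [← e.tsum_eq (fun p => |F p - G p|), hA.tsum_prod]
  have hle : ∀ k : ℤ, |f k - g k| ≤ ∑' m : ℕ, |F (e (k, m)) - G (e (k, m))| := by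
    intro k
    have a1 : Summable fun m : ℕ => F (e (k, m)) := hF'.prod_factor k
    have a2 : Summable fun m : ℕ => G (e (k, m)) := hG'.prod_factor k
    have a3 : Summable fun m : ℕ => ‖F (e (k, m)) - G (e (k, m))‖ := (a1.sub a2).norm
    rw [hf, hg, ← a1.tsum_sub a2]
    have a4 := norm_tsum_le_tsum_norm a3
    simpa only [Real.norm_eq_abs] using a4
  have hS : Summable fun k : ℤ => ∑' m : ℕ, |F (e (k, m)) - G (e (k, m))| := hA.prod
  have hL : Summable fun k : ℤ => |f k - g k| :=
    Summable.of_nonneg_of_le (fun _ => abs_nonneg _) hle hS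
  exact Summable.tsum_le_tsum hle hL hS

theorem tendsto_shifted_trace_norm (N c : ℝ) (hN : 0 < N) (hc : 0 < c) :
    Filter.Tendsto
      (fun n : ℕ =>
        ∑' k : ℤ,
          |(if 0 ≤ (n : ℤ) + k then Pl N n ((n : ℤ) + k).toNat (c / n) else 0) - qdist N c k|)
      Filter.atTop (nhds 0) := by
  obtain ⟨n0, hn0⟩ := exists_nat_gt (c * N)
  have hn0' : 0 < n0 := by
    have : (0 : ℝ) < n0 := lt_trans (by positivity) hn0
    exact_mod_cast this
  have hG := Gterm_summable N c hN hc
  have hB := bnd_summable N c hN hc n0 hn0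
  have hcn : ∀ᶠ n : ℕ in atTop, c ≤ n := tendsto_natCast_atTop_atTop.eventually_ge_atTop c
  have hdom : ∀ᶠ n : ℕ in atTop, ∀ p, ‖|Fterm N (c / n) n p - Gterm N c p|‖ ≤
      bnd N c n0 p + Gterm N c p := by
    filter_upwards [hcn, eventually_ge_atTop n0] with n h1 h2 p
    have := Fterm_nonneg N c hN hc n h1 p
    have := Fterm_le N c hN hc n0 n hn0' h2 h1 p
    have := Gterm_nonneg N c hN hc p
    rw [Real.norm_eq_abs, abs_abs, abs_le]
    constructor <;> linarith
  have hlim : Tendsto (fun n : ℕ => ∑' p, |Fterm N (c / n) n p - Gterm N c p|) atTop (𝓝 0) := by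
    have := tendsto_tsum_of_dominated_convergence (g := fun _ : ℕ × ℕ => (0 : ℝ)) (hB.add hG)
      (fun p => by
        have h := ((Fterm_tendsto N c p).sub_const (Gterm N c p)).abs
        simpa using h) hdom
    simpa using this
  refine tendsto_of_tendsto_of_tendsto_of_le_of_le' tendsto_const_nhds hlim
    (Eventually.of_forall fun n => tsum_nonneg fun k => abs_nonneg _) ?_
  filter_upwards [hcn, eventually_ge_atTop n0, hdom] with n h1 h2 h3
  have hF : Summable (Fterm N (c / n) n) :=
    Summable.of_nonneg_of_le (Fterm_nonneg N c hN hc n h1)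
      (Fterm_le N c hN hc n0 n hn0' h2 h1) hB
  exact abstract_le eqv (Fterm N (c / n) n) (Gterm N c) _ _ hF hG
    (Pl_eq N (c / n) n) (qdist_eq N c)
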